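/- Let V be a finite-dimensional real normed vector space, γ ⊆ V a closed proper convex cone with nonempty interior, K ⊆ V a compact set, and u a continuous linear functional on V lying in the interior of the polar cone γ°. Then the restriction of u to K + γ is a proper map: for every compact subset S ⊆ ℝ, the set (K + γ) ∩ u⁻¹(S) is compact. -/

import Mathlib

open Pointwise

/-- A functional in the interior of the polar cone of `γ` is coercive on `γ`. -/
theorem exists_pos_mul_norm_le_of_mem_interior_polar
    {V : Type*} [NormedAddCommGroup V] [NormedSpace ℝ V] {γ : Set V} {u : V →L[ℝ] ℝ}
    (hu : u ∈ interior {w : V →L[ℝ] ℝ | ∀ x ∈ γ, 0 ≤ w x}) :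
    ∃ c : ℝ, 0 < c ∧ ∀ x ∈ γ, c * ‖x‖ ≤ u x := by
  obtain ⟨ε, hε, hball⟩ := Metric.nhds_basis_closedBall.mem_iff.1 (mem_interior_iff_mem_nhds.1 hu)
  refine ⟨ε, hε, fun x hx => ?_⟩
  obtain ⟨g, hg, hgx⟩ := exists_dual_vector'' ℝ x
  have hmem : u - ε • g ∈ Metric.closedBall u ε := by
    rw [mem_closedBall_iff_norm, sub_sub_cancel_left, norm_neg, norm_smul, Real.norm_of_nonneg hε.le]
    exact mul_le_of_le_one_right hε.le hg
  have hnonneg : 0 ≤ u x - ε * g x := hball hmem x hx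
  rw [hgx] at hnonneg
  exact sub_nonneg.1 hnonneg

/-- if `γ` is a closed proper convex cone with nonempty interior in a
finite-dimensional real normed vector space, `K` is compact and `u` is a continuous
linear functional in the interior of the polar cone `γ°`, then the restriction of `u` to
`K + γ` is proper: preimages of compact subsets of `ℝ` intersected with `K + γ` are
compact. -/
theorem proper_on_compact_add_cone
    {V : Type*} [NormedAddCommGroup V] [NormedSpace ℝ V] [FiniteDimensional ℝ V]
    (γ : Set V) (hzero : (0 : V) ∈ γ)
    (hsmul : ∀ t : ℝ, 0 < t → t • γ ⊆ γ)
    (hconv : Convex ℝ γ)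
    (hproper : γ ∩ (-γ) = {0})
    (hclosed : IsClosed γ)
    (hint : (interior γ).Nonempty)
    (K : Set V) (hK : IsCompact K)
    (u : V →L[ℝ] ℝ)
    (hu : u ∈ interior {w : V →L[ℝ] ℝ | ∀ x ∈ γ, 0 ≤ w x}) :
    ∀ S : Set ℝ, IsCompact S → IsCompact ((K + γ) ∩ u ⁻¹' S) := by
  intro S hS
  obtain ⟨c, hc, hcoercive⟩ := exists_pos_mul_norm_le_of_mem_interior_polar hu
  obtain ⟨R, hR⟩ := hK.isBounded.exists_norm_le
  obtain ⟨M, hM⟩ := hS.isBounded.exists_norm_le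
  have : ProperSpace V := FiniteDimensional.proper_real V
  refine Metric.isCompact_of_isClosed_isBounded
    ((hclosed.add_left_of_isCompact hK).inter (hS.isClosed.preimage u.continuous))
    (isBounded_iff_forall_norm_le.2 ⟨R + (M + ‖u‖ * R) / c, ?_⟩)
  rintro _ ⟨⟨k, hk, y, hy, rfl⟩, hxS⟩
  have hy_norm : ‖y‖ ≤ (M + ‖u‖ * R) / c := by
    rw [le_div_iff₀' hc]
    calc c * ‖y‖ ≤ u y := hcoercive y hy
      _ = u (k + y) - u k := by rw [map_add, add_sub_cancel_left]
      _ ≤ ‖u (k + y)‖ + ‖u k‖ := (Real.le_norm_self _).trans (norm_sub_le _ _)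
      _ ≤ M + ‖u‖ * R := add_le_add (hM _ hxS) (u.le_opNorm_of_le (hR k hk))
  exact (norm_add_le k y).trans (add_le_add (hR k hk) hy_norm)
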